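/- arXiv:2401.07087 — 4 statements merged into one kernel-verified Lean document; each statement's English description precedes it below -/
import Mathlib

section
/- Let (E, μ) be a probability space over a real inner product space E, let L_F, L_G : E → ℝ be measurable, let δ : E → E be measurable, and let L₁, L₂ ∈ ℝ. Write x' = x + δ(x), and suppose all four sets below are measurable. Set γ_F = μ{x : L_F(x) > L₁} and γ_G = μ{x : L_G(x) > L₂}, and suppose α ∈ [0,1] satisfies μ{x : L_F(x') > L₁} ≥ 1 − α. Then μ{x : L_F(x) ≤ L₁ ∧ L_G(x) ≤ L₂ ∧ L_F(x') > L₁ ∧ L_G(x') > L₂} ≥ (1 − α) − (γ_F + γ_G) − μ{x : L_G(x') ≤ L₂}. -/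
open MeasureTheory

/-- Union bound step: the measure of the adversarial-transferability event
`{L_F(x) ≤ L₁ ∧ L_G(x) ≤ L₂ ∧ L_F(x') > L₁ ∧ L_G(x') > L₂}` (where `x' = x + δ(x)`)
is at least `(1 − α) − (γ_F + γ_G) − μ{L_G(x') ≤ L₂}`. -/
theorem stmt_2 {E : Type*} [NormedAddCommGroup E] [InnerProductSpace ℝ E]
    [MeasurableSpace E]
    (μ : Measure E) [IsProbabilityMeasure μ]
    (LF LG : E → ℝ) (hLF : Measurable LF) (hLG : Measurable LG)
    (δ : E → E) (hδ : Measurable δ) (L₁ L₂ α : ℝ) (hα : α ∈ Set.Icc (0 : ℝ) 1)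
    (hm₁ : MeasurableSet {x : E | LF x > L₁})
    (hm₂ : MeasurableSet {x : E | LG x > L₂})
    (hm₃ : MeasurableSet {x : E | LF (x + δ x) > L₁})
    (hm₄ : MeasurableSet {x : E | LG (x + δ x) ≤ L₂})
    (heff : 1 - α ≤ (μ {x : E | LF (x + δ x) > L₁}).toReal) :
    (μ {x : E | LF x ≤ L₁ ∧ LG x ≤ L₂ ∧ LF (x + δ x) > L₁ ∧ LG (x + δ x) > L₂}).toReal ≥
      (1 - α) - ((μ {x : E | LF x > L₁}).toReal + (μ {x : E | LG x > L₂}).toReal) -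
        (μ {x : E | LG (x + δ x) ≤ L₂}).toReal := by
  set T := {x : E | LF x ≤ L₁ ∧ LG x ≤ L₂ ∧ LF (x + δ x) > L₁ ∧ LG (x + δ x) > L₂}
  have hsub : {x : E | LF (x + δ x) > L₁} ⊆
      ((T ∪ {x | LF x > L₁}) ∪ {x | LG x > L₂}) ∪ {x | LG (x + δ x) ≤ L₂} := by
    intro x hx
    simp only [T, Set.mem_union, Set.mem_ofPred_eq] at hx ⊢
    grind
  simp only [← measureReal_def] at heff ⊢
  have hmono := measureReal_mono (μ := μ) hsub
  have h₁ := measureReal_union_le (μ := μ)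
    ((T ∪ {x | LF x > L₁}) ∪ {x | LG x > L₂}) {x | LG (x + δ x) ≤ L₂}
  have h₂ := measureReal_union_le (μ := μ) (T ∪ {x | LF x > L₁}) {x | LG x > L₂}
  have h₃ := measureReal_union_le (μ := μ) T {x | LF x > L₁}
  linarith
end

section
/- Let E be a real inner product space and μ a probability measure on E. Let L_F : E → ℝ be differentiable with β-Lipschitz gradient (β ≥ 0) and ∇L_F(x) ≠ 0 for all x. Let δ : E → E be measurable with ‖δ(x)‖ ≤ ε for all x, where ε > 0, and let L₁ ∈ ℝ and α ∈ [0,1] satisfy μ{x : L_F(x + δ(x)) > L₁} ≥ 1 − α (all sets appearing assumed measurable). Then μ{x : ⟪δ(x), ∇L_F(x)/‖∇L_F(x)‖⟫ ≤ (L₁ − L_F(x) − βε²/2)/‖∇L_F(x)‖} ≤ α. -/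
open MeasureTheory RealInnerProductSpace

/-- The descent lemma: a function with `β`-Lipschitz gradient lies below its quadratic upper
model. -/
theorem le_add_inner_gradient_add_of_lipschitz_gradient {E : Type*} [NormedAddCommGroup E]
    [InnerProductSpace ℝ E] [CompleteSpace E] {f : E → ℝ} {β : ℝ} (hf : Differentiable ℝ f)
    (hLip : ∀ x y : E, ‖gradient f x - gradient f y‖ ≤ β * ‖x - y‖) (x v : E) :
    f (x + v) ≤ f x + ⟪v, gradient f x⟫ + β * ‖v‖ ^ 2 / 2 := by
  have hline (t : ℝ) : HasDerivAt (fun t : ℝ => f (x + t • v)) ⟪gradient f (x + t • v), v⟫ t := by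
    have h₁ : HasDerivAt (fun t : ℝ => x + t • v) v t := by
      simpa using ((hasDerivAt_id t).smul_const v).const_add x
    exact (hf (x + t • v)).hasGradientAt.hasFDerivAt.comp_hasDerivAt t h₁
  have hderiv (t : ℝ) : HasDerivAt
      (fun t : ℝ => f (x + t • v) - t * ⟪gradient f x, v⟫ - t ^ 2 * (β * ‖v‖ ^ 2 / 2))
      (⟪gradient f (x + t • v), v⟫ - ⟪gradient f x, v⟫ - t * (β * ‖v‖ ^ 2)) t := by
    refine (((hline t).sub ((hasDerivAt_id t).mul_const ⟪gradient f x, v⟫)).sub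
      ((hasDerivAt_pow 2 t).mul_const (β * ‖v‖ ^ 2 / 2))).congr_deriv ?_
    norm_num
    ring
  have hanti : AntitoneOn
      (fun t : ℝ => f (x + t • v) - t * ⟪gradient f x, v⟫ - t ^ 2 * (β * ‖v‖ ^ 2 / 2))
      (Set.Icc 0 1) := by
    refine antitoneOn_of_deriv_nonpos (convex_Icc 0 1)
      (fun t _ => (hderiv t).continuousAt.continuousWithinAt)
      (fun t _ => (hderiv t).differentiableAt.differentiableWithinAt) fun t ht => ?_
    rw [interior_Icc] at ht
    rw [(hderiv t).deriv, ← inner_sub_left, sub_nonpos]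
    calc ⟪gradient f (x + t • v) - gradient f x, v⟫
        ≤ ‖gradient f (x + t • v) - gradient f x‖ * ‖v‖ := real_inner_le_norm _ _
      _ ≤ β * ‖x + t • v - x‖ * ‖v‖ := by gcongr; exact hLip _ _
      _ = t * (β * ‖v‖ ^ 2) := by
        rw [add_sub_cancel_left, norm_smul, Real.norm_of_nonneg ht.1.le]
        ring
  have h := hanti (Set.left_mem_Icc.2 zero_le_one) (Set.right_mem_Icc.2 zero_le_one) zero_le_one
  simp only [one_smul, zero_smul, add_zero] at h
  rw [real_inner_comm]
  linarith

/-- If the adversarial perturbation `δ` (with `‖δ(x)‖ ≤ ε`) is `(α, F)`-effective at level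
`L₁` for a `β`-smooth loss `L_F` with nonvanishing gradient, then the probability that the
projection of `δ(x)` onto the normalized gradient is at most
`f(x) = (L₁ − L_F(x) − βε²/2)/‖∇L_F(x)‖` is at most `α`. -/
theorem stmt_3 {E : Type*} [NormedAddCommGroup E] [InnerProductSpace ℝ E] [CompleteSpace E]
    [MeasurableSpace E]
    (μ : Measure E) [IsProbabilityMeasure μ]
    (LF : E → ℝ) (β : ℝ) (hβ : 0 ≤ β) (hLF : Differentiable ℝ LF)
    (hLip : ∀ x₁ x₂ : E, ‖gradient LF x₁ - gradient LF x₂‖ ≤ β * ‖x₁ - x₂‖)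
    (hgrad : ∀ x : E, gradient LF x ≠ 0)
    (δ : E → E) (hδm : Measurable δ) (ε : ℝ) (hε : 0 < ε) (hδ : ∀ x : E, ‖δ x‖ ≤ ε)
    (L₁ α : ℝ) (hα : α ∈ Set.Icc (0 : ℝ) 1)
    (hm₁ : MeasurableSet {x : E | LF (x + δ x) > L₁})
    (hm₂ : MeasurableSet
      {x : E | ⟪δ x, ‖gradient LF x‖⁻¹ • gradient LF x⟫ ≤
        (L₁ - LF x - β * ε ^ 2 / 2) / ‖gradient LF x‖})
    (heff : 1 - α ≤ (μ {x : E | LF (x + δ x) > L₁}).toReal) :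
    (μ {x : E | ⟪δ x, ‖gradient LF x‖⁻¹ • gradient LF x⟫ ≤
        (L₁ - LF x - β * ε ^ 2 / 2) / ‖gradient LF x‖}).toReal ≤ α := by
  have hdisj : Disjoint {x : E | LF (x + δ x) > L₁}
      {x : E | ⟪δ x, ‖gradient LF x‖⁻¹ • gradient LF x⟫ ≤
        (L₁ - LF x - β * ε ^ 2 / 2) / ‖gradient LF x‖} := by
    refine Set.disjoint_left.2 fun x hx hx' => ?_
    simp only [Set.mem_ofPred_eq] at hx hx'
    rw [real_inner_smul_right, inv_mul_eq_div,
      div_le_div_iff_of_pos_right (norm_pos_iff.2 (hgrad x))] at hx'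
    have hdesc := le_add_inner_gradient_add_of_lipschitz_gradient hLF hLip x (δ x)
    have hquad : β * ‖δ x‖ ^ 2 ≤ β * ε ^ 2 := by
      gcongr
      exact hδ x
    linarith
  have hsum := measureReal_union (μ := μ) hdisj hm₂
  have hle := measureReal_le_one (μ := μ) (s := {x : E | LF (x + δ x) > L₁} ∪
    {x : E | ⟪δ x, ‖gradient LF x‖⁻¹ • gradient LF x⟫ ≤
      (L₁ - LF x - β * ε ^ 2 / 2) / ‖gradient LF x‖})
  simp only [← measureReal_def] at heff ⊢
  linarith
end

section
/- Let E be a real inner product space and μ a probability measure on E. Let L_F, L_G : E → ℝ be differentiable with ∇L_F(x) ≠ 0 and ∇L_G(x) ≠ 0 for all x. Let δ : E → E be measurable with ‖δ(x)‖ ≤ ε for all x, where ε > 0. Let f : E → ℝ be a function and c_F, s, α ∈ ℝ with α ∈ [0,1] such that: (i) c_F ≤ f(x) for all x; (ii) s ≤ ⟪∇L_F(x), ∇L_G(x)⟫/(‖∇L_F(x)‖·‖∇L_G(x)‖) for all x; and (iii) μ{x : ⟪δ(x), ∇L_F(x)/‖∇L_F(x)‖⟫ ≤ f(x)} ≤ α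 (all sets appearing assumed measurable). Then μ{x : ⟪δ(x), ∇L_G(x)/‖∇L_G(x)‖⟫ ≤ c_F − ε·√(2 − 2s)} ≤ α. -/
open MeasureTheory RealInnerProductSpace

/-- The distance between the normalizations of two nonzero vectors is at most `√(2 - 2s)` when
`s` bounds their cosine similarity from below. -/
theorem norm_normalize_sub_normalize_le {E : Type*} [NormedAddCommGroup E]
    [InnerProductSpace ℝ E] {a b : E} (ha : a ≠ 0) (hb : b ≠ 0) {s : ℝ}
    (hs : s ≤ ⟪a, b⟫ / (‖a‖ * ‖b‖)) :
    ‖‖a‖⁻¹ • a - ‖b‖⁻¹ • b‖ ≤ Real.sqrt (2 - 2 * s) := by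
  apply Real.le_sqrt_of_sq_le
  have hna : ‖‖a‖⁻¹ • a‖ = 1 := norm_smul_inv_norm (𝕜 := ℝ) ha
  have hnb : ‖‖b‖⁻¹ • b‖ = 1 := norm_smul_inv_norm (𝕜 := ℝ) hb
  have hab : ⟪‖a‖⁻¹ • a, ‖b‖⁻¹ • b⟫ = ⟪a, b⟫ / (‖a‖ * ‖b‖) := by
    rw [real_inner_smul_left, real_inner_smul_right, div_eq_mul_inv, mul_inv]
    ring
  rw [norm_sub_sq_real, hna, hnb, hab]
  linarith

/-- Transferring a probabilistic bound on the projection of the perturbation `δ` onto the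
normalized surrogate gradient to one onto the normalized target gradient, losing a term
`ε·√(2 − 2s)` where `s` is a lower bound for the loss gradient (cosine) similarity. -/
theorem stmt_5 {E : Type*} [NormedAddCommGroup E] [InnerProductSpace ℝ E] [CompleteSpace E]
    [MeasurableSpace E]
    (μ : Measure E) [IsProbabilityMeasure μ]
    (LF LG : E → ℝ) (hLF : Differentiable ℝ LF) (hLG : Differentiable ℝ LG)
    (hgradF : ∀ x : E, gradient LF x ≠ 0) (hgradG : ∀ x : E, gradient LG x ≠ 0)
    (δ : E → E) (hδm : Measurable δ) (ε : ℝ) (hε : 0 < ε) (hδ : ∀ x : E, ‖δ x‖ ≤ ε)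
    (f : E → ℝ) (cF s α : ℝ) (hα : α ∈ Set.Icc (0 : ℝ) 1)
    (hcF : ∀ x : E, cF ≤ f x)
    (hs : ∀ x : E, s ≤ ⟪gradient LF x, gradient LG x⟫ / (‖gradient LF x‖ * ‖gradient LG x‖))
    (hm₁ : MeasurableSet {x : E | ⟪δ x, ‖gradient LF x‖⁻¹ • gradient LF x⟫ ≤ f x})
    (hm₂ : MeasurableSet {x : E | ⟪δ x, ‖gradient LG x‖⁻¹ • gradient LG x⟫ ≤
      cF - ε * Real.sqrt (2 - 2 * s)})
    (hF : (μ {x : E | ⟪δ x, ‖gradient LF x‖⁻¹ • gradient LF x⟫ ≤ f x}).toReal ≤ α) :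
    (μ {x : E | ⟪δ x, ‖gradient LG x‖⁻¹ • gradient LG x⟫ ≤
      cF - ε * Real.sqrt (2 - 2 * s)}).toReal ≤ α := by
  refine (ENNReal.toReal_mono (measure_ne_top μ _) (measure_mono fun x hx => ?_)).trans hF
  simp only [Set.mem_ofPred_eq] at hx ⊢
  set u := ‖gradient LF x‖⁻¹ • gradient LF x
  set v := ‖gradient LG x‖⁻¹ • gradient LG x
  have huv : ‖u - v‖ ≤ Real.sqrt (2 - 2 * s) :=
    norm_normalize_sub_normalize_le (hgradF x) (hgradG x) (hs x)
  have hdiff : ⟪δ x, u - v⟫ ≤ ε * Real.sqrt (2 - 2 * s) :=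
    (real_inner_le_norm _ _).trans (mul_le_mul (hδ x) huv (norm_nonneg _) hε.le)
  rw [inner_sub_right] at hdiff
  linarith [hcF x]
end

section
/- Let (Ω, μ) be a probability space, let Z : Ω → ℝ be measurable with |Z(ω)| ≤ ε for μ-almost every ω, where ε > 0, and let c, c_G ∈ ℝ and α ∈ [0,1] satisfy μ{ω : Z(ω) ≤ c} ≤ α and c_G < ε. Then μ{ω : Z(ω) ≤ c_G} ≤ (ε·(1 + α) − c·(1 − α))/(ε − c_G). -/
open MeasureTheory

/-- A lower bound on the expectation of a random variable that is at least `-ε` almost everywhere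
and exceeds `c` outside an event of probability at most `α`. -/
theorem le_integral_of_measureReal_le {Ω : Type*} [MeasurableSpace Ω]
    {μ : Measure Ω} [IsProbabilityMeasure μ] {Z : Ω → ℝ} (hZ : Measurable Z)
    (hint : Integrable Z μ) {ε c α : ℝ} (hlb : ∀ᵐ ω ∂μ, -ε ≤ Z ω) (hα : α ≤ 1)
    (hprob : μ.real {ω | Z ω ≤ c} ≤ α) :
    -ε * α + c * (1 - α) ≤ ∫ ω, Z ω ∂μ := by
  rcases lt_or_ge c (-ε) with hc | hc
  · have h : ∫ _, -ε ∂μ ≤ ∫ ω, Z ω ∂μ := integral_mono_ae (integrable_const _) hint hlb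
    simp only [integral_const, probReal_univ, one_smul] at h
    nlinarith
  · have hs : MeasurableSet {ω | Z ω ≤ c} := measurableSet_le hZ measurable_const
    have hind : Integrable ({ω | Z ω ≤ c}.indicator fun _ => ε + c) μ :=
      (integrable_const _).indicator hs
    have h : ∫ ω, (c - {ω | Z ω ≤ c}.indicator (fun _ => ε + c) ω) ∂μ ≤ ∫ ω, Z ω ∂μ := by
      refine integral_mono_ae ((integrable_const _).sub hind) hint ?_
      filter_upwards [hlb] with ω hω
      by_cases hω' : Z ω ≤ c
      · simpa [hω'] using hω
      · simpa [hω'] using (not_le.mp hω').le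
    rw [integral_sub (integrable_const _) hind, integral_indicator_const _ hs] at h
    simp only [integral_const, probReal_univ, smul_eq_mul] at h
    nlinarith

/-- Markov-inequality step: if `|Z| ≤ ε` a.e., `μ{Z ≤ c} ≤ α` and `c_G < ε`, then
`μ{Z ≤ c_G} ≤ (ε·(1 + α) − c·(1 − α))/(ε − c_G)`. -/
theorem stmt_7 {Ω : Type*} [MeasurableSpace Ω]
    (μ : Measure Ω) [IsProbabilityMeasure μ]
    (Z : Ω → ℝ) (hZ : Measurable Z) (ε : ℝ) (hε : 0 < ε)
    (hbd : ∀ᵐ ω ∂μ, |Z ω| ≤ ε)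
    (c cG α : ℝ) (hα : α ∈ Set.Icc (0 : ℝ) 1)
    (hprob : (μ {ω : Ω | Z ω ≤ c}).toReal ≤ α) (hcG : cG < ε) :
    (μ {ω : Ω | Z ω ≤ cG}).toReal ≤ (ε * (1 + α) - c * (1 - α)) / (ε - cG) := by
  have hint : Integrable Z μ := .of_bound hZ.aestronglyMeasurable ε hbd
  have hmean := le_integral_of_measureReal_le hZ hint
    (hbd.mono fun ω hω => (abs_le.mp hω).1) hα.2 hprob
  have hmarkov := mul_meas_ge_le_integral_of_nonneg (μ := μ) (f := fun ω => ε - Z ω)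
    (hbd.mono fun ω hω => sub_nonneg.mpr (abs_le.mp hω).2)
    ((integrable_const _).sub hint) (ε - cG)
  simp only [sub_le_sub_iff_left] at hmarkov
  rw [integral_sub (integrable_const _) hint, integral_const, probReal_univ, one_smul] at hmarkov
  rw [le_div_iff₀ (sub_pos.mpr hcG), mul_comm]
  refine hmarkov.trans ?_
  linarith
end
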